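/- The generating polynomial K_n(q) for desarrangements of order n by number of inversions equals the generating polynomial D_n(q) for derangements of order n by major index. -/

import Mathlib

open Finset

attribute [local instance] Classical.propDecidable

noncomputable section

/-- The word `x_1 x_2 ... x_n` (0-indexed) of a signed permutation of order `n`,
encoded as a pair (permutation, signs): `x_i = ±(σ(i)+1)`. -/
def sword (n : ℕ) (w : Equiv.Perm (Fin n) × (Fin n → Bool)) : ℕ → ℤ :=
  fun i => if h : i < n then
      (if w.2 ⟨i, h⟩ then -(((w.1 ⟨i, h⟩ : ℕ) : ℤ) + 1) else (((w.1 ⟨i, h⟩ : ℕ) : ℤ) + 1))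
    else 0

/-- number of negative letters -/
def negStat (n : ℕ) (x : ℕ → ℤ) : ℕ := ((Finset.range n).filter (fun i => x i < 0)).card

/-- number of positive fixed points (`x_i = i`, 1-indexed) -/
def fixPlus (n : ℕ) (x : ℕ → ℤ) : ℕ :=
  ((Finset.range n).filter (fun i => x i = (i : ℤ) + 1)).card

/-- number of negative fixed points (`x_i = -i`, 1-indexed) -/
def fixMinus (n : ℕ) (x : ℕ → ℤ) : ℕ :=
  ((Finset.range n).filter (fun i => x i = -((i : ℤ) + 1))).card

/-- major index of the word -/
def majStat (n : ℕ) (x : ℕ → ℤ) : ℕ :=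
  ∑ i ∈ Finset.range (n - 1), if x (i + 1) < x i then i + 1 else 0

/-- number of inversions of the word -/
def invStat (n : ℕ) (x : ℕ → ℤ) : ℕ :=
  ((Finset.range n ×ˢ Finset.range n).filter (fun p => p.1 < p.2 ∧ x p.2 < x p.1)).card

/-- length function `ℓ(w) = inv w + ∑_{x_i<0} |x_i|` -/
def lenStat (n : ℕ) (x : ℕ → ℤ) : ℕ :=
  invStat n x + ∑ i ∈ Finset.range n, if x i < 0 then (x i).natAbs else 0

/-- flag-major index `fmaj = 2 maj + neg` -/
def fmajStat (n : ℕ) (x : ℕ → ℤ) : ℕ := 2 * majStat n x + negStat n x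

/-- the word `x_0 ... x_{m-1}` has its leftmost trough at position `2k` (1-indexed):
`x_1 > x_2 > ... > x_{2k}` and `x_{2k} < x_{2k+1}` (with `x_{m+1} = ∞`). -/
def IsDesarAt (m k : ℕ) (x : ℕ → ℤ) : Prop :=
  1 ≤ k ∧ 2 * k ≤ m ∧ (∀ i, i + 1 < 2 * k → x (i + 1) < x i) ∧
    (2 * k = m ∨ x (2 * k - 1) < x (2 * k))

/-- a word of length `m` is a desarrangement (empty word included) -/
def IsDesar (m : ℕ) (x : ℕ → ℤ) : Prop :=
  m = 0 ∨ ∃ k, IsDesarAt m k x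

/-- the length of the longest right factor of the word of length `n`
which is a desarrangement -/
def dlen (n : ℕ) (x : ℕ → ℤ) : ℕ :=
  sSup {m | m ≤ n ∧ IsDesar m (fun i => x (n - m + i))}

/-- number of letters of `w^-` in the pixed factorization `w = w^- w^+ w^d` -/
def pixMinus (n : ℕ) (x : ℕ → ℤ) : ℕ :=
  ((Finset.range (n - dlen n x)).filter (fun i => x i < 0)).card

/-- number of letters of `w^+` in the pixed factorization `w = w^- w^+ w^d` -/
def pixPlus (n : ℕ) (x : ℕ → ℤ) : ℕ :=
  ((Finset.range (n - dlen n x)).filter (fun i => 0 < x i)).card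

/-- the number of derangements of an `m`-element set -/
def dnum (m : ℕ) : ℕ :=
  (Finset.univ.filter (fun σ : Equiv.Perm (Fin m) => ∀ i, σ i ≠ i)).card

/-- the word of an ordinary permutation of `{1, ..., m}` -/
def pword (m : ℕ) (σ : Equiv.Perm (Fin m)) : ℕ → ℤ :=
  fun i => if h : i < m then ((σ ⟨i, h⟩ : ℕ) : ℤ) + 1 else 0

/-- the q-ascending factorial `(q;q)_m` -/
def qq {K : Type*} [CommRing K] (q : K) (m : ℕ) : K :=
  ∏ i ∈ Finset.range m, (1 - q ^ (i + 1))

/-- `D_m(q)`: generating polynomial for derangements of order `m` by major index -/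
def Dmaj {K : Type*} [CommRing K] (q : K) (m : ℕ) : K :=
  ∑ σ ∈ Finset.univ.filter (fun σ : Equiv.Perm (Fin m) => ∀ i, σ i ≠ i),
    q ^ majStat m (pword m σ)


/-! ### Gaussian binomial coefficients -/

/-- the `q`-integer -/
def qn {K : Type*} [CommRing K] (q : K) (m : ℕ) : K := ∑ i ∈ Finset.range m, q ^ i

/-- the Gaussian binomial coefficient -/
def qb {K : Type*} [CommRing K] (q : K) : ℕ → ℕ → K
  | _, 0 => 1
  | 0, _ + 1 => 0
  | n + 1, k + 1 => qb q n k + q ^ (k + 1) * qb q n (k + 1)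

section qbinom
variable {K : Type*} [CommRing K] (q : K)

lemma qb_zero_right (n : ℕ) : qb q n 0 = 1 := by cases n <;> rfl

lemma qb_succ (n k : ℕ) : qb q (n + 1) (k + 1) = qb q n k + q ^ (k + 1) * qb q n (k + 1) := rfl

lemma qb_of_lt {n : ℕ} : ∀ {k : ℕ}, n < k → qb q n k = 0 := by
  induction n with
  | zero => intro k hk; cases k with
    | zero => omega
    | succ k => rfl
  | succ n ih => intro k hk; cases k with
    | zero => omega
    | succ k => rw [qb_succ, ih (by omega), ih (by omega)]; simp

lemma qb_self (n : ℕ) : qb q n n = 1 := by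
  induction n with
  | zero => rfl
  | succ n ih => rw [qb_succ, ih, qb_of_lt q (by omega)]; simp

lemma qb_succ' (n : ℕ) : ∀ k, k ≤ n →
    qb q (n + 1) (k + 1) = q ^ (n - k) * qb q n k + qb q n (k + 1) := by
  induction n with
  | zero => intro k hk; obtain rfl : k = 0 := by omega
            simp [qb]
  | succ n ih =>
    intro k hk
    rcases Nat.eq_or_lt_of_le hk with rfl | hlt
    · rw [qb_self, qb_self, qb_of_lt q (by omega)]; simp
    cases k with
    | zero =>
      rw [qb_succ, ih 0 (by omega), qb_zero_right, qb_zero_right]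
      have := qb_succ q n 0
      rw [ih 0 (by omega), qb_zero_right] at this
      simp only [Nat.sub_zero, zero_add, pow_one, mul_one] at this ⊢
      rw [pow_succ]
      linear_combination -this
    | succ k =>
      rw [qb_succ q (n+1) (k+1), ih k (by omega), ih (k+1) (by omega)]
      have h1 := qb_succ q n k
      have h2 := qb_succ q n (k+1)
      rw [ih k (by omega)] at h1
      rw [ih (k+1) (by omega)] at h2
      obtain ⟨m, rfl⟩ : ∃ m, n = k + 1 + m := ⟨n - (k+1), by omega⟩
      have e1 : k + 1 + m - k = m + 1 := by omega
      have e2 : k + 1 + m - (k+1) = m := by omega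
      have e3 : k + 1 + m + 1 - (k+1) = m + 1 := by omega
      rw [e1] at h1
      rw [e2] at h2
      rw [e1, e2, e3]
      linear_combination -h2 - q ^ (m + 1) * h1

lemma qn_succ (n : ℕ) : qn q (n + 1) = q * qn q n + 1 := by
  unfold qn
  rw [Finset.sum_range_succ', Finset.mul_sum]
  simp [pow_succ, mul_comm]

lemma qb_mul_qn (n : ℕ) : ∀ k, qb q (n + 1) (k + 1) * qn q (k + 1) = qn q (n + 1) * qb q n k := by
  induction n with
  | zero => intro k; cases k with
    | zero => simp [qb, qn]
    | succ k => simp [qb]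
  | succ n ih =>
    intro k
    rw [qb_succ, add_mul, mul_assoc, ih k]
    cases k with
    | zero => rw [qb_zero_right, qb_zero_right, qn_succ q (n+1)]; simp [qn]; ring
    | succ k =>
      have h := ih k
      have h3 := qb_succ q n k
      rw [qn_succ q (k+1), qn_succ q (n+1)]
      linear_combination q * h - q * qn q (n+1) * h3

lemma qb_alt (n : ℕ) :
    ∑ k ∈ Finset.range (n + 2), (-1) ^ k * q ^ (k.choose 2) * qb q (n + 1) k = 0 := by
  rw [Finset.sum_range_succ']
  simp only [qb_succ, qb_zero_right]
  have h : ∀ m, ∑ k ∈ Finset.range m, (-1) ^ (k+1) * q ^ ((k+1).choose 2) *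
      (qb q n k + q ^ (k+1) * qb q n (k+1)) = (-1) ^ m * q ^ ((m+1).choose 2) * qb q n m - 1 := by
    intro m
    induction m with
    | zero => simp [qb_zero_right]
    | succ m ih =>
      rw [Finset.sum_range_succ, ih, Nat.choose_succ_succ' (m+1) 1, Nat.choose_one_right, pow_add]
      ring
  rw [h, qb_of_lt q (by omega)]
  simp

/-- A sequence satisfying the desarrangement recurrence has the `q`-binomial transform `[n]!`. -/
lemma transform_of_rec (a : ℕ → K) (h0 : a 0 = 1)
    (hs : ∀ n, a (n + 1) = qn q (n + 1) * a n + (-1) ^ (n + 1) * q ^ ((n + 1).choose 2)) (n : ℕ) :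
    ∑ k ∈ Finset.range (n + 2), qb q (n + 1) k * a k
      = qn q (n + 1) * ∑ k ∈ Finset.range (n + 1), qb q n k * a k := by
  have h := qb_alt q n
  rw [Finset.sum_range_succ'] at h ⊢
  simp only [hs, h0, qb_zero_right, mul_add, Finset.sum_add_distrib] at h ⊢
  rw [Finset.mul_sum]
  have e : ∀ k, qb q (n+1) (k+1) * (qn q (k+1) * a k) = qn q (n+1) * (qb q n k * a k) := by
    intro k
    rw [← mul_assoc, qb_mul_qn, mul_assoc]
  simp only [e]
  have e2 : ∑ k ∈ Finset.range (n+1), qb q (n+1) (k+1) * ((-1) ^ (k+1) * q ^ ((k+1).choose 2))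
     = ∑ k ∈ Finset.range (n+1), (-1) ^ (k+1) * q ^ ((k+1).choose 2) * qb q (n+1) (k+1) :=
    Finset.sum_congr rfl fun _ _ => by ring
  rw [e2]
  simp at h ⊢
  linear_combination h

lemma eq_of_transform (a b : ℕ → K)
    (h : ∀ n, ∑ k ∈ Finset.range (n + 1), qb q n k * a k
      = ∑ k ∈ Finset.range (n + 1), qb q n k * b k) (n : ℕ) : a n = b n := by
  induction n using Nat.strong_induction_on with
  | _ n ih =>
    have h1 := h n
    rw [Finset.sum_range_succ, Finset.sum_range_succ, qb_self,
      Finset.sum_congr rfl (fun k hk => by rw [ih k (Finset.mem_range.1 hk)])] at h1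
    simpa using h1

end qbinom

/-! ### Shuffles of a word with zeros -/

/-- the word having the letters of `α` at the positions in `T` and zeros elsewhere -/
def shw (α : ℕ → ℤ) (T : Finset ℕ) (i : ℕ) : ℤ :=
  if i ∈ T then α ((T.filter (fun j => j < i)).card) else 0

lemma majStat_congr {n : ℕ} {x y : ℕ → ℤ}
    (h : ∀ i, i + 1 < n → (x (i + 1) < x i ↔ y (i + 1) < y i)) : majStat n x = majStat n y := by
  unfold majStat
  refine Finset.sum_congr rfl fun i hi => ?_
  have := Finset.mem_range.1 hi
  simp only [h i (by omega)]

lemma majStat_one (x : ℕ → ℤ) : majStat 1 x = 0 := by simp [majStat]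

lemma majStat_succ (n : ℕ) (x : ℕ → ℤ) :
    majStat (n + 2) x = majStat (n + 1) x + if x (n + 1) < x n then n + 1 else 0 := by
  simp only [majStat, Nat.add_sub_cancel, show n + 2 - 1 = n + 1 by omega]
  rw [Finset.sum_range_succ]

lemma shw_insert_lt (α : ℕ → ℤ) (T : Finset ℕ) {n i : ℕ} (h : i < n) :
    shw α (insert n T) i = shw α T i := by
  unfold shw
  rw [Finset.filter_insert, if_neg (show ¬ n < i by omega)]
  simp [show i ≠ n by omega]

lemma shw_insert_self (α : ℕ → ℤ) (T : Finset ℕ) {n k : ℕ}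
    (h : T ∈ Finset.powersetCard k (Finset.range n)) : shw α (insert n T) n = α k := by
  obtain ⟨h1, h2⟩ := Finset.mem_powersetCard.1 h
  unfold shw
  rw [Finset.filter_insert, if_neg (lt_irrefl n), Finset.filter_true_of_mem]
  · simp [h2]
  · intro j hj; exact Finset.mem_range.1 (h1 hj)

lemma shw_self (α : ℕ → ℤ) (T : Finset ℕ) {n k : ℕ}
    (h : T ∈ Finset.powersetCard k (Finset.range n)) (m : ℕ) (hm : n ≤ m) : shw α T m = 0 := by
  obtain ⟨h1, h2⟩ := Finset.mem_powersetCard.1 h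
  unfold shw
  rw [if_neg]
  intro hj; have := Finset.mem_range.1 (h1 hj); omega

lemma majStat_insert (α : ℕ → ℤ) (T : Finset ℕ) (n : ℕ) :
    majStat n (shw α (insert n T)) = majStat n (shw α T) :=
  majStat_congr fun i hi => by rw [shw_insert_lt α T hi, shw_insert_lt α T (by omega)]

lemma psc_empty (k : ℕ) : Finset.powersetCard (k + 1) (∅ : Finset ℕ) = ∅ :=
  Finset.powersetCard_eq_empty.2 (by simp)

lemma sum_psc {M : Type*} [AddCommMonoid M] (f : Finset ℕ → M) (n k : ℕ) :
    ∑ T ∈ Finset.powersetCard (k + 1) (Finset.range (n + 1)), f T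
      = ∑ T ∈ Finset.powersetCard k (Finset.range n), f (insert n T)
        + ∑ T ∈ Finset.powersetCard (k + 1) (Finset.range n), f T := by
  have e : Finset.range (n + 1) = insert n (Finset.range n) := by
    ext; simp; omega
  rw [e, Finset.powersetCard_succ_insert (by simp), Finset.sum_union, Finset.sum_image, add_comm]
  · intro a ha b hb hab
    have ha' : n ∉ a := fun h => by
      have := (Finset.mem_powersetCard.1 ha).1 h; simp at this
    have hb' : n ∉ b := fun h => by
      have := (Finset.mem_powersetCard.1 hb).1 h; simp at this
    have hab' : insert n a = insert n b := hab
    rw [← Finset.erase_insert ha', ← Finset.erase_insert hb', hab']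
  · rw [Finset.disjoint_left]
    intro a ha hb
    obtain ⟨b, -, rfl⟩ := Finset.mem_image.1 hb
    have := (Finset.mem_powersetCard.1 ha).1 (Finset.mem_insert_self n b)
    simp at this

section shuffle
variable {K : Type*} [CommRing K] (q : K)

/-- shuffles ending with a letter of `α` -/
def shA (α : ℕ → ℤ) (n k : ℕ) : K :=
  ∑ T ∈ Finset.powersetCard k (Finset.range n), q ^ majStat (n + 1) (shw α (insert n T))

/-- shuffles ending with a zero -/
def shB (α : ℕ → ℤ) (n k : ℕ) : K :=
  ∑ T ∈ Finset.powersetCard k (Finset.range n), q ^ majStat (n + 1) (shw α T)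

lemma shA_zero (α : ℕ → ℤ) (n : ℕ) :
    shA q α (n + 1) 0 = shB q α n 0 * q ^ (if α 0 < 0 then n + 1 else 0) := by
  have h : (∅ : Finset ℕ) ∈ Finset.powersetCard 0 (Finset.range (n+1)) := by simp
  simp only [shA, shB, Finset.powersetCard_zero, Finset.sum_singleton]
  rw [majStat_succ, majStat_insert, shw_insert_self α _ h, shw_insert_lt α _ (by omega),
    shw_self α ∅ (n := 0) (k := 0) (by simp) n (by omega), pow_add]

lemma shB_zero (α : ℕ → ℤ) (n : ℕ) : shB q α n 0 = 1 := by
  simp [shB, majStat, shw]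

lemma shA_succ (α : ℕ → ℤ) (n k : ℕ) :
    shA q α (n + 1) (k + 1) = shA q α n k * q ^ (if α (k + 1) < α k then n + 1 else 0)
      + shB q α n (k + 1) * q ^ (if α (k + 1) < 0 then n + 1 else 0) := by
  unfold shA
  rw [sum_psc, Finset.sum_mul, shB, Finset.sum_mul]
  congr 1
  · refine Finset.sum_congr rfl fun T hT => ?_
    have hT' : insert n T ∈ Finset.powersetCard (k+1) (Finset.range (n+1)) := by
      obtain ⟨h1, h2⟩ := Finset.mem_powersetCard.1 hT
      rw [Finset.mem_powersetCard]
      constructor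
      · intro j hj
        rcases Finset.mem_insert.1 hj with rfl | hj
        · simp
        · have := Finset.mem_range.1 (h1 hj); simp; omega
      · rw [Finset.card_insert_of_notMem, h2]
        intro hj; have := Finset.mem_range.1 (h1 hj); omega
    rw [majStat_succ, majStat_insert, shw_insert_self α _ hT', shw_insert_lt α _ (by omega),
      shw_insert_self α _ hT, pow_add]
  · refine Finset.sum_congr rfl fun T hT => ?_
    have hT' : T ∈ Finset.powersetCard (k+1) (Finset.range (n+1)) :=
      Finset.powersetCard_mono (by intro j; simp; omega) hT
    rw [majStat_succ, majStat_insert, shw_insert_self α _ hT', shw_insert_lt α _ (by omega),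
      shw_self α _ hT n le_rfl, pow_add]

lemma shB_succ (α : ℕ → ℤ) (n k : ℕ) :
    shB q α (n + 1) (k + 1) = shA q α n k * q ^ (if 0 < α k then n + 1 else 0)
      + shB q α n (k + 1) := by
  unfold shB
  rw [sum_psc, shA, Finset.sum_mul]
  congr 1
  · refine Finset.sum_congr rfl fun T hT => ?_
    rw [majStat_succ, shw_insert_self α _ hT, pow_add]
    have : shw α (insert n T) (n+1) = 0 := by
      obtain ⟨h1, h2⟩ := Finset.mem_powersetCard.1 hT
      unfold shw
      rw [if_neg]
      intro hj
      rcases Finset.mem_insert.1 hj with hj | hj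
      · omega
      · have := Finset.mem_range.1 (h1 hj); omega
    rw [this]
  · refine Finset.sum_congr rfl fun T hT => ?_
    rw [majStat_succ, shw_self α _ hT n le_rfl, shw_self α _ hT (n+1) (by omega)]
    simp

lemma shAB (α : ℕ → ℤ) (k₀ : ℕ) (hα : ∀ i < k₀, α i ≠ 0) (n : ℕ) :
    (∀ k, k < k₀ → shA q α n k
      = q ^ (majStat (k + 1) α) * q ^ (if α k < 0 then n - k else 0) * qb q n k) ∧
    (∀ k, k < k₀ → shB q α n (k + 1)
      = q ^ (majStat (k + 1) α) * q ^ (if 0 < α k then k + 1 else 0) * qb q n (k + 1)) := by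
  induction n with
  | zero =>
    constructor
    · intro k hk
      cases k with
      | zero => simp [shA, qb, majStat_one]
      | succ k => simp [shA, qb, psc_empty]
    · intro k hk
      simp [shB, qb, psc_empty]
  | succ n ih =>
    obtain ⟨ihA, ihB⟩ := ih
    constructor
    · intro k hk
      cases k with
      | zero => rw [shA_zero, shB_zero, qb_zero_right, majStat_one]; simp
      | succ k =>
        rw [shA_succ, ihA k (by omega), ihB k (by omega), majStat_succ]
        have h1 := hα k (by omega)
        have h2 := hα (k+1) (by omega)
        rcases Nat.lt_or_ge n k with hnk | hnk
        · rw [qb_of_lt q (show n < k by omega), qb_of_lt q (show n < k + 1 by omega),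
            qb_of_lt q (show n + 1 < k + 1 by omega)]
          simp
        have e1 := qb_succ q n k
        have e2 := qb_succ' q n k hnk
        obtain ⟨m, rfl⟩ : ∃ m, n = k + m := ⟨n - k, by omega⟩
        have e3 : k + m - k = m := by omega
        have e4 : k + m + 1 - (k + 1) = m := by omega
        rw [e3] at e2
        rw [e3, e4]
        rcases lt_or_gt_of_ne h1 with s1 | s1 <;> rcases lt_or_gt_of_ne h2 with s2 | s2 <;>
          have s1' := not_lt.2 s1.le <;> have s2' := not_lt.2 s2.le
        · by_cases d : α (k + 1) < α k <;> simp only [s1, s2, s1', d, if_true, if_false]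
          · rw [e2]; ring
          · rw [e1]; ring
        · have d : ¬ α (k + 1) < α k := by omega
          simp only [s1, s2', s1', d, if_true, if_false]
          rw [e2]; ring
        · have d : α (k + 1) < α k := by omega
          simp only [s1, s2, s1', d, if_true, if_false]
          rw [e1]; ring
        · by_cases d : α (k + 1) < α k <;> simp only [s1, s2', s1', d, if_true, if_false]
          · rw [e2]; ring
          · rw [e1]; ring
    · intro k hk
      rw [shB_succ, ihA k (by omega), ihB k (by omega)]
      have h1 := hα k (by omega)
      rcases Nat.lt_or_ge n k with hnk | hnk
      · rw [qb_of_lt q (show n < k by omega), qb_of_lt q (show n < k + 1 by omega),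
          qb_of_lt q (show n + 1 < k + 1 by omega)]
        simp
      rw [qb_succ' q n k hnk]
      rcases lt_or_gt_of_ne h1 with s1 | s1
      · simp only [s1, not_lt.2 s1.le, if_true, if_false]; ring
      · simp only [s1, not_lt.2 s1.le, if_true, if_false]
        obtain ⟨m, rfl⟩ : ∃ m, n = k + m := ⟨n - k, by omega⟩
        have e3 : k + m - k = m := by omega
        rw [e3]; ring

lemma shuffle_sum (α : ℕ → ℤ) (k : ℕ) (hα : ∀ i < k, α i ≠ 0) (n : ℕ) :
    ∑ T ∈ Finset.powersetCard k (Finset.range n), q ^ majStat n (shw α T)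
      = qb q n k * q ^ majStat k α := by
  cases k with
  | zero => simp [qb_zero_right, majStat, shw]
  | succ k =>
    cases n with
    | zero => simp [qb, psc_empty]
    | succ n =>
      rw [sum_psc]
      obtain ⟨hA, hB⟩ := shAB q α (k+1) hα n
      have hA := hA k (by omega)
      have hB := hB k (by omega)
      unfold shA at hA
      unfold shB at hB
      rw [hA, hB]
      have h1 := hα k (by omega)
      rcases Nat.lt_or_ge n k with hnk | hnk
      · rw [qb_of_lt q (show n < k by omega), qb_of_lt q (show n < k + 1 by omega),
          qb_of_lt q (show n + 1 < k + 1 by omega)]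
        simp
      rcases lt_or_gt_of_ne h1 with s1 | s1
      · simp only [s1, not_lt.2 s1.le, if_true, if_false]; rw [qb_succ' q n k hnk]; ring
      · simp only [s1, not_lt.2 s1.le, if_true, if_false]; rw [qb_succ q n k]; ring

end shuffle

/-! ### Inserting a letter into a permutation -/

/-- the permutation sending `p` to `r` and acting as `τ` on the rest -/
def insP {n : ℕ} (p r : Fin (n + 1)) (τ : Equiv.Perm (Fin n)) : Equiv.Perm (Fin (n + 1)) :=
  ((finSuccEquiv' p).trans (Equiv.optionCongr τ)).trans (finSuccEquiv' r).symm

lemma insP_self {n : ℕ} (p r : Fin (n + 1)) (τ : Equiv.Perm (Fin n)) : insP p r τ p = r := by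
  simp [insP]

lemma insP_succAbove {n : ℕ} (p r : Fin (n + 1)) (τ : Equiv.Perm (Fin n)) (i : Fin n) :
    insP p r τ (p.succAbove i) = r.succAbove (τ i) := by
  simp [insP]

lemma insP_inj {n : ℕ} {p r : Fin (n + 1)} {τ τ' : Equiv.Perm (Fin n)}
    (h : insP p r τ = insP p r τ') : τ = τ' := by
  ext i
  have := congrArg (fun s => s (p.succAbove i)) h
  simp only [insP_succAbove] at this
  rw [Fin.succAbove_right_injective this]

lemma sum_insP_pos {M : Type*} [AddCommMonoid M] {n : ℕ} (r : Fin (n + 1))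
    (f : Equiv.Perm (Fin (n + 1)) → M) :
    ∑ σ, f σ = ∑ τ : Equiv.Perm (Fin n), ∑ p : Fin (n + 1), f (insP p r τ) := by
  rw [← Fintype.sum_prod_type' (fun τ p => f (insP p r τ))]
  symm
  refine Fintype.sum_bijective (fun a : Equiv.Perm (Fin n) × Fin (n + 1) => insP a.2 r a.1) ?_ _ _
    (fun _ => rfl)
  rw [Fintype.bijective_iff_injective_and_card]
  constructor
  · rintro ⟨τ, p⟩ ⟨τ', p'⟩ h
    have h : insP p r τ = insP p' r τ' := h
    have hp : p = p' := by
      apply (insP p r τ).injective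
      rw [insP_self, h, insP_self]
    subst hp
    rw [insP_inj h]
  · simp [Fintype.card_perm, Nat.factorial_succ, mul_comm]

lemma sum_insP_val {M : Type*} [AddCommMonoid M] {n : ℕ} (p : Fin (n + 1))
    (f : Equiv.Perm (Fin (n + 1)) → M) :
    ∑ σ, f σ = ∑ τ : Equiv.Perm (Fin n), ∑ r : Fin (n + 1), f (insP p r τ) := by
  rw [← Fintype.sum_prod_type' (fun τ r => f (insP p r τ))]
  symm
  refine Fintype.sum_bijective (fun a : Equiv.Perm (Fin n) × Fin (n + 1) => insP p a.2 a.1) ?_ _ _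
    (fun _ => rfl)
  rw [Fintype.bijective_iff_injective_and_card]
  constructor
  · rintro ⟨τ, r⟩ ⟨τ', r'⟩ h
    have h : insP p r τ = insP p r' τ' := h
    have hp : r = r' := by
      rw [← insP_self p r τ, h, insP_self]
    subst hp
    rw [insP_inj h]
  · simp [Fintype.card_perm, Nat.factorial_succ, mul_comm]

/-! ### The generating function for `maj` on all permutations -/

lemma pword_lt {n : ℕ} (σ : Equiv.Perm (Fin n)) {i : ℕ} (h : i < n) :
    pword n σ i = ((σ ⟨i, h⟩ : ℕ) : ℤ) + 1 := by
  simp [pword, h]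

lemma pword_fin {n : ℕ} (σ : Equiv.Perm (Fin n)) (i : Fin n) :
    pword n σ i = ((σ i : ℕ) : ℤ) + 1 := pword_lt σ i.2

lemma qb_succ_self {K : Type*} [CommRing K] (q : K) (n : ℕ) : qb q (n + 1) n = qn q (n + 1) := by
  induction n with
  | zero => simp [qb, qn]
  | succ n ih => rw [qb_succ, ih, qb_self, qn, qn, Finset.sum_range_succ _ (n+1)]; simp

lemma card_erase_lt {n p i : ℕ} (hi : i ≤ n) :
    (((Finset.range (n + 1)).erase p).filter (fun j => j < i)).card
      = if p < i then i - 1 else i := by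
  split_ifs with h
  · have : ((Finset.range (n + 1)).erase p).filter (fun j => j < i) = (Finset.range i).erase p := by
      ext j; simp; omega
    rw [this, Finset.card_erase_of_mem (by simpa using h), Finset.card_range]
  · have : ((Finset.range (n + 1)).erase p).filter (fun j => j < i) = Finset.range i := by
      ext j; simp; omega
    rw [this, Finset.card_range]

lemma maj_insP_zero {n : ℕ} (p : Fin (n + 1)) (τ : Equiv.Perm (Fin n)) :
    majStat (n + 1) (pword (n + 1) (insP p 0 τ))
      = majStat (n + 1) (shw (pword n τ) ((Finset.range (n + 1)).erase p)) := by
  have key : ∀ i, i < n + 1 → pword (n + 1) (insP p 0 τ) i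
      = shw (pword n τ) ((Finset.range (n + 1)).erase p) i + 1 := by
    intro i hi
    unfold shw
    rw [card_erase_lt (by omega)]
    by_cases hp : (⟨i, hi⟩ : Fin (n+1)) = p
    · subst hp
      rw [pword_lt _ hi, insP_self]; simp
    · obtain ⟨j, hj⟩ := Fin.exists_succAbove_eq hp
      have hne : i ≠ (p : ℕ) := fun h => hp (Fin.ext h)
      rw [pword_lt _ hi, ← hj, insP_succAbove, if_pos (by simp [hne]; omega)]
      have hij : (if (p : ℕ) < i then i - 1 else i) = j := by
        have h2 := congrArg Fin.val hj
        simp only [Fin.succAbove, Fin.lt_def, Fin.val_castSucc] at h2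
        split_ifs at h2 ⊢ <;> simp at h2 <;> omega
      rw [hij, pword_fin]
      simp
  refine majStat_congr fun i hi => ?_
  rw [key i (by omega), key (i+1) hi]
  omega

lemma sum_erase {M : Type*} [AddCommMonoid M] (n : ℕ) (f : Finset ℕ → M) :
    ∑ p : Fin (n + 1), f ((Finset.range (n + 1)).erase p)
      = ∑ T ∈ Finset.powersetCard n (Finset.range (n + 1)), f T := by
  refine Finset.sum_bij (fun p _ => (Finset.range (n + 1)).erase p) ?_ ?_ ?_ (fun _ _ => rfl)
  · intro p _
    rw [Finset.mem_powersetCard]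
    refine ⟨Finset.erase_subset _ _, ?_⟩
    rw [Finset.card_erase_of_mem (Finset.mem_range.2 p.2)]; simp
  · intro p _ p' _ h
    by_contra hne
    have : (p : ℕ) ∈ (Finset.range (n + 1)).erase (p' : ℕ) := by
      simp [Fin.val_inj, hne]; omega
    rw [← h] at this
    simp at this
  · intro T hT
    obtain ⟨h1, h2⟩ := Finset.mem_powersetCard.1 hT
    have hc : (Finset.range (n + 1) \ T).card = 1 := by
      rw [Finset.card_sdiff_of_subset h1, h2]; simp
    obtain ⟨p, hp⟩ := Finset.card_eq_one.1 hc
    have hpm : p ∈ Finset.range (n + 1) \ T := by rw [hp]; simp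
    have hpr := Finset.mem_range.1 (Finset.mem_sdiff.1 hpm).1
    refine ⟨⟨p, hpr⟩, Finset.mem_univ _, ?_⟩
    rw [← Finset.sdiff_singleton_eq_erase, ← hp]
    simp [Finset.inter_eq_right.2 h1]

lemma sum_maj_succ {K : Type*} [CommRing K] (q : K) (n : ℕ) :
    ∑ σ : Equiv.Perm (Fin (n + 1)), q ^ majStat (n + 1) (pword (n + 1) σ)
      = qn q (n + 1) * ∑ τ : Equiv.Perm (Fin n), q ^ majStat n (pword n τ) := by
  rw [sum_insP_pos 0, Finset.mul_sum]
  refine Finset.sum_congr rfl fun τ _ => ?_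
  simp only [maj_insP_zero]
  rw [sum_erase n (fun T => q ^ majStat (n + 1) (shw (pword n τ) T)), shuffle_sum, qb_succ_self]
  intro i hi
  rw [pword_lt _ hi]; omega

/-! ### The recurrence for desarrangements -/

/-- fully decreasing words -/
def IsDec (m : ℕ) (x : ℕ → ℤ) : Prop := ∀ i, i + 1 < m → x (i + 1) < x i

lemma desar_step {K : Type*} [CommRing K] (n : ℕ) (x : ℕ → ℤ)
    (hx : ∀ i, i + 1 < n + 1 → x (i + 1) ≠ x i) :
    (if IsDesar (n + 1) x then (1 : K) else 0)
      = (if IsDesar n x then 1 else 0) + (-1) ^ (n + 1) * (if IsDec (n + 1) x then 1 else 0) := by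
  by_cases h : IsDesar n x
  · rcases Nat.eq_zero_or_pos n with rfl | hn
    · have h1 : ¬ IsDesar 1 x := by
        rintro (h | ⟨k, h1, h2, -⟩) <;> omega
      have h2 : IsDec 1 x := by intro i hi; omega
      simp [h, h1, h2]
    · rcases h with h | ⟨k, h1, h2, h3, h4⟩
      · omega
      have hd : IsDesar n x := Or.inr ⟨k, h1, h2, h3, h4⟩
      by_cases h5 : 2 * k = n ∧ x n < x (n - 1)
      · obtain ⟨h5, h6⟩ := h5
        have hdec : IsDec (n + 1) x := by
          intro i hi
          by_cases hi' : i + 1 = n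
          · have e : i = n - 1 := by omega
            rw [hi', e]; exact h6
          · exact h3 i (by omega)
        have hnd : ¬ IsDesar (n + 1) x := by
          rintro (h | ⟨k', g1, g2, g3, g4⟩)
          · omega
          · have := hdec (2 * k' - 1) (by omega)
            rw [show 2 * k' - 1 + 1 = 2 * k' by omega] at this
            rcases g4 with g4 | g4
            · omega
            · omega
        have : (-1 : K) ^ (n + 1) = -1 := Odd.neg_one_pow ⟨k, by omega⟩
        simp [hd, hdec, hnd, this]
      · have h6 : x (2 * k - 1) < x (2 * k) := by
          rcases h4 with h4 | h4
          · have h7 : ¬ x n < x (n - 1) := fun g => h5 ⟨h4, g⟩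
            have h8 := hx (n - 1) (by omega)
            rw [show n - 1 + 1 = n by omega] at h8
            rw [h4]; omega
          · exact h4
        have hd' : IsDesar (n + 1) x := Or.inr ⟨k, h1, by omega, h3, Or.inr h6⟩
        have hnd : ¬ IsDec (n + 1) x := by
          intro g
          have := g (2 * k - 1) (by omega)
          rw [show 2 * k - 1 + 1 = 2 * k by omega] at this
          omega
        simp [hd, hd', hnd]
  · have hn : n ≠ 0 := fun g => h (Or.inl g)
    by_cases hdec : IsDec (n + 1) x
    · have hodd : Odd n := by
        by_contra hev
        rw [Nat.not_odd_iff_even] at hev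
        obtain ⟨k, hk⟩ := hev
        exact h (Or.inr ⟨k, by omega, by omega, fun i hi => hdec i (by omega), Or.inl (by omega)⟩)
      obtain ⟨k, hk⟩ := hodd
      have hd' : IsDesar (n + 1) x :=
        Or.inr ⟨k + 1, by omega, by omega, fun i hi => hdec i (by omega), Or.inl (by omega)⟩
      have : (-1 : K) ^ (n + 1) = 1 := Even.neg_one_pow ⟨k + 1, by omega⟩
      simp [h, hdec, hd', this]
    · have hd' : ¬ IsDesar (n + 1) x := by
        rintro (g | ⟨k, h1, h2, h3, h4⟩)
        · omega
        by_cases h5 : 2 * k = n + 1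
        · exact hdec fun i hi => h3 i (by omega)
        · refine h (Or.inr ⟨k, h1, by omega, h3, ?_⟩)
          rcases h4 with h4 | h4
          · omega
          · exact Or.inr h4
      simp [h, hdec, hd']

lemma isDesar_congr {n : ℕ} {x y : ℕ → ℤ} (h : ∀ i j, i < n → j < n → (x i < x j ↔ y i < y j)) :
    IsDesar n x ↔ IsDesar n y := by
  unfold IsDesar IsDesarAt
  constructor
  · rintro (g | ⟨k, h1, h2, h3, h4⟩)
    · exact Or.inl g
    · refine Or.inr ⟨k, h1, h2, fun i hi => (h _ _ (by omega) (by omega)).1 (h3 i hi), ?_⟩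
      by_cases h5 : 2 * k = n
      · exact Or.inl h5
      · exact Or.inr ((h _ _ (by omega) (by omega)).1 (h4.resolve_left h5))
  · rintro (g | ⟨k, h1, h2, h3, h4⟩)
    · exact Or.inl g
    · refine Or.inr ⟨k, h1, h2, fun i hi => (h _ _ (by omega) (by omega)).2 (h3 i hi), ?_⟩
      by_cases h5 : 2 * k = n
      · exact Or.inl h5
      · exact Or.inr ((h _ _ (by omega) (by omega)).2 (h4.resolve_left h5))

lemma invStat_congr {n : ℕ} {x y : ℕ → ℤ} (h : ∀ i j, i < n → j < n → (x i < x j ↔ y i < y j)) :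
    invStat n x = invStat n y := by
  unfold invStat
  congr 1
  refine Finset.filter_congr fun p hp => ?_
  rw [Finset.mem_product, Finset.mem_range, Finset.mem_range] at hp
  rw [h _ _ hp.2 hp.1]

lemma invStat_succ (n : ℕ) (x : ℕ → ℤ) :
    invStat (n + 1) x = invStat n x + ((Finset.range n).filter (fun i => x n < x i)).card := by
  unfold invStat
  simp only [Finset.card_filter, Finset.sum_product]
  rw [Finset.sum_range_succ]
  simp only [Finset.sum_range_succ _ n, Finset.sum_add_distrib]
  have h1 : ∑ j ∈ Finset.range n, (if n < j ∧ x j < x n then 1 else 0) = 0 :=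
    Finset.sum_eq_zero fun j hj => if_neg fun g => by
      have := Finset.mem_range.1 hj; omega
  have h2 : ∑ i ∈ Finset.range n, (if i < n ∧ x n < x i then 1 else 0)
      = ∑ i ∈ Finset.range n, (if x n < x i then 1 else 0) :=
    Finset.sum_congr rfl fun j hj => by simp [Finset.mem_range.1 hj]
  rw [h1, h2]
  simp

lemma pword_insP_last {n : ℕ} (r : Fin (n + 1)) (τ : Equiv.Perm (Fin n)) {i : ℕ} (h : i < n) :
    pword (n + 1) (insP (Fin.last n) r τ) i = ((r.succAbove (τ ⟨i, h⟩) : ℕ) : ℤ) + 1 := by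
  rw [pword_lt _ (show i < n + 1 by omega)]
  have : (⟨i, by omega⟩ : Fin (n+1)) = (Fin.last n).succAbove ⟨i, h⟩ := by
    rw [Fin.succAbove_last]; rfl
  rw [this, insP_succAbove]

lemma pword_insP_last_self {n : ℕ} (r : Fin (n + 1)) (τ : Equiv.Perm (Fin n)) :
    pword (n + 1) (insP (Fin.last n) r τ) n = ((r : ℕ) : ℤ) + 1 := by
  rw [pword_lt _ (show n < n + 1 by omega)]
  have : (⟨n, by omega⟩ : Fin (n+1)) = Fin.last n := rfl
  rw [this, insP_self]

lemma insP_order {n : ℕ} (r : Fin (n + 1)) (τ : Equiv.Perm (Fin n)) (i j : ℕ) (hi : i < n)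
    (hj : j < n) : pword (n + 1) (insP (Fin.last n) r τ) i < pword (n + 1) (insP (Fin.last n) r τ) j
      ↔ pword n τ i < pword n τ j := by
  rw [pword_insP_last r τ hi, pword_insP_last r τ hj, pword_lt _ hi, pword_lt _ hj]
  have := (Fin.strictMono_succAbove r).lt_iff_lt (a := τ ⟨i, hi⟩) (b := τ ⟨j, hj⟩)
  simp only [Fin.lt_def] at this
  omega

lemma inv_insP {n : ℕ} (r : Fin (n + 1)) (τ : Equiv.Perm (Fin n)) :
    invStat (n + 1) (pword (n + 1) (insP (Fin.last n) r τ))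
      = invStat n (pword n τ) + (n - r) := by
  rw [invStat_succ, invStat_congr (insP_order r τ)]
  congr 1
  rw [pword_insP_last_self]
  have e : n - (r : ℕ) = ((Finset.Ico (r : ℕ) n)).card := by simp
  rw [e]
  refine Finset.card_bij (fun i hi =>
    (τ ⟨i, Finset.mem_range.1 (Finset.mem_filter.1 hi).1⟩ : ℕ)) ?_ ?_ ?_
  · intro i hi
    obtain ⟨h1, h2⟩ := Finset.mem_filter.1 hi
    have h1 := Finset.mem_range.1 h1
    rw [pword_insP_last r τ h1] at h2
    simp only [Fin.succAbove, Fin.lt_def, Fin.val_castSucc] at h2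
    rw [Finset.mem_Ico]
    split_ifs at h2 <;> simp at h2 <;> omega
  · intro i hi j hj h
    have := τ.injective (Fin.ext h)
    simpa using this
  · intro b hb
    rw [Finset.mem_Ico] at hb
    refine ⟨(τ.symm ⟨b, hb.2⟩ : ℕ), ?_, by simp⟩
    rw [Finset.mem_filter]
    refine ⟨by simp, ?_⟩
    rw [pword_insP_last r τ (by simp)]
    simp only [Fin.eta, Equiv.apply_symm_apply, Fin.succAbove, Fin.lt_def, Fin.val_castSucc]
    rw [if_neg (by omega)]
    simp; omega

lemma isDec_insP {n : ℕ} (r : Fin (n + 1)) (τ : Equiv.Perm (Fin n)) :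
    IsDec (n + 1) (pword (n + 1) (insP (Fin.last n) r τ)) ↔ r = 0 ∧ IsDec n (pword n τ) := by
  constructor
  · intro h
    refine ⟨?_, fun i hi => (insP_order r τ _ _ hi (by omega)).1 (h i (by omega))⟩
    by_contra hr
    set σ := insP (Fin.last n) r τ with hσ
    have hanti : ∀ d i, i + d + 1 < n + 1 → pword (n+1) σ (i + d + 1) < pword (n+1) σ i := by
      intro d
      induction d with
      | zero => intro i hi; exact h i hi
      | succ d ih =>
        intro i hi
        exact lt_trans (h _ hi) (ih i (by omega))
    have h0 : σ (Fin.last n) = r := insP_self _ _ _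
    set j := σ.symm 0 with hj
    have hσj : σ j = 0 := by simp [hj]
    have hjl : j ≠ Fin.last n := by
      intro g; rw [g, h0] at hσj; exact hr hσj
    have hjn : (j : ℕ) < n := by
      have := j.2
      have : (j : ℕ) ≠ n := fun g => hjl (Fin.ext g)
      omega
    have := hanti (n - j - 1) j (by omega)
    rw [show (j : ℕ) + (n - j - 1) + 1 = n by omega, pword_fin, hσj, hσ, pword_insP_last_self] at this
    simp at this
    omega
  · rintro ⟨rfl, h⟩ i hi
    by_cases hin : i + 1 = n
    · rw [hin, pword_insP_last_self, pword_insP_last _ _ (by omega)]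
      simp
    · exact (insP_order 0 τ _ _ (by omega) (by omega)).2 (h i (by omega))

section desar
variable {K : Type*} [CommRing K] (q : K)

/-- `K_n(q)` -/
def Kinv (n : ℕ) : K := ∑ σ : Equiv.Perm (Fin n),
  (if IsDesar n (pword n σ) then 1 else 0) * q ^ invStat n (pword n σ)

lemma sum_dec (n : ℕ) : ∑ σ : Equiv.Perm (Fin n),
    (if IsDec n (pword n σ) then (1 : K) else 0) * q ^ invStat n (pword n σ)
      = q ^ (n.choose 2) := by
  induction n with
  | zero =>
    simp [IsDec, invStat]
  | succ n ih =>
    rw [sum_insP_val (Fin.last n), Nat.choose_succ_succ' n 1, Nat.choose_one_right, pow_add, ← ih,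
      Finset.mul_sum]
    refine Finset.sum_congr rfl fun τ _ => ?_
    simp only [isDec_insP, inv_insP]
    rw [Finset.sum_eq_single 0]
    · simp [pow_add]; split_ifs <;> ring
    · intro r _ hr; simp [hr]
    · simp

lemma sum_qn (n : ℕ) : ∑ r : Fin (n + 1), q ^ (n - (r : ℕ)) = qn q (n + 1) := by
  rw [Fin.sum_univ_eq_sum_range (fun r => q ^ (n - r)) (n + 1), qn,
    ← Finset.sum_range_reflect]
  refine Finset.sum_congr rfl fun i hi => ?_
  have := Finset.mem_range.1 hi
  congr 1
  omega

lemma Kinv_succ (n : ℕ) : Kinv q (n + 1)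
    = qn q (n + 1) * Kinv q n + (-1) ^ (n + 1) * q ^ ((n + 1).choose 2) := by
  rw [← sum_dec, Finset.mul_sum]
  have h1 : qn q (n + 1) * Kinv q n = ∑ τ : Equiv.Perm (Fin n), ∑ r : Fin (n + 1),
      (if IsDesar n (pword (n + 1) (insP (Fin.last n) r τ)) then 1 else 0)
        * q ^ invStat (n + 1) (pword (n + 1) (insP (Fin.last n) r τ)) := by
    rw [Kinv, Finset.mul_sum]
    refine Finset.sum_congr rfl fun τ _ => ?_
    rw [← sum_qn, Finset.sum_mul]
    refine Finset.sum_congr rfl fun r _ => ?_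
    rw [inv_insP, pow_add]
    simp only [isDesar_congr (insP_order r τ)]
    ring
  rw [h1, ← sum_insP_val (Fin.last n) (fun σ => (if IsDesar n (pword (n + 1) σ) then (1 : K) else 0)
        * q ^ invStat (n + 1) (pword (n + 1) σ)), ← Finset.sum_add_distrib, Kinv]
  refine Finset.sum_congr rfl fun σ _ => ?_
  rw [desar_step]
  · ring
  · intro i hi h
    rw [pword_lt _ hi, pword_lt _ (show i < n + 1 by omega)] at h
    have h' : (σ ⟨i + 1, hi⟩) = σ ⟨i, by omega⟩ := Fin.ext (by omega)
    have := σ.injective h'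
    simp at this

end desar

/-! ### Decomposition of permutations by their fixed points -/

/-- the word of a derangement, with subexcedant letters made negative -/
def dword {k : ℕ} (π : Equiv.Perm (Fin k)) (j : ℕ) : ℤ :=
  if h : j < k then
    (if j < (π ⟨j, h⟩ : ℕ) then ((π ⟨j, h⟩ : ℕ) : ℤ) + 1 else ((π ⟨j, h⟩ : ℕ) : ℤ) - k)
  else 0

lemma dword_fin {k : ℕ} (π : Equiv.Perm (Fin k)) (a : Fin k) :
    dword π a = if (a : ℕ) < (π a : ℕ) then ((π a : ℕ) : ℤ) + 1 else ((π a : ℕ) : ℤ) - k := by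
  simp [dword]

lemma dword_pos {k : ℕ} (π : Equiv.Perm (Fin k)) (a : Fin k) :
    0 < dword π a ↔ (a : ℕ) < (π a : ℕ) := by
  have := (π a).2
  rw [dword_fin]; split_ifs <;> omega

lemma dword_neg {k : ℕ} (π : Equiv.Perm (Fin k)) (hπ : ∀ i, π i ≠ i) (a : Fin k) :
    dword π a < 0 ↔ (π a : ℕ) < (a : ℕ) := by
  have := (π a).2
  have h : (π a : ℕ) ≠ a := fun g => hπ a (Fin.ext g)
  rw [dword_fin]; split_ifs <;> omega

lemma dword_ne {k : ℕ} (π : Equiv.Perm (Fin k)) (i : ℕ) (hi : i < k) : dword π i ≠ 0 := by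
  have := (π ⟨i, hi⟩).2
  simp only [dword, hi, dif_pos]
  split_ifs <;> omega

lemma dword_desc {k : ℕ} (π : Equiv.Perm (Fin k)) (hπ : ∀ i, π i ≠ i) (a b : Fin k)
    (h : (b : ℕ) = a + 1) : dword π b < dword π a ↔ π b < π a := by
  have h1 := (π a).2
  have h2 := (π b).2
  have h3 : (π a : ℕ) ≠ a := fun g => hπ a (Fin.ext g)
  have h4 : (π b : ℕ) ≠ b := fun g => hπ b (Fin.ext g)
  rw [dword_fin, dword_fin, Fin.lt_def]
  split_ifs <;> omega

lemma maj_dword {k : ℕ} (π : Equiv.Perm (Fin k)) (hπ : ∀ i, π i ≠ i) :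
    majStat k (dword π) = majStat k (pword k π) := by
  refine majStat_congr fun i hi => ?_
  have := dword_desc π hπ ⟨i, by omega⟩ ⟨i + 1, hi⟩ rfl
  rw [pword_lt _ hi, pword_lt _ (show i < k by omega)]
  rw [Fin.lt_def] at this
  simp only at this
  omega

lemma maj_decomp {n k : ℕ} (T : Finset ℕ) (f : Fin k → Fin n) (hf : StrictMono f)
    (hT : ∀ i : ℕ, i ∈ T ↔ ∃ a, (f a : ℕ) = i) (σ : Equiv.Perm (Fin n)) (π : Equiv.Perm (Fin k))
    (hπ : ∀ i, π i ≠ i) (h1 : ∀ a, σ (f a) = f (π a)) (h2 : ∀ i : Fin n, (i : ℕ) ∉ T → σ i = i) :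
    majStat n (pword n σ) = majStat n (shw (dword π) T) := by
  have hin : ∀ a, shw (dword π) T (f a) = dword π a := by
    intro a
    unfold shw
    rw [if_pos ((hT _).2 ⟨a, rfl⟩)]
    congr 1
    have : T.filter (fun j => j < (f a : ℕ)) = (Finset.Iio a).image (fun b => (f b : ℕ)) := by
      ext j
      rw [Finset.mem_filter, hT, Finset.mem_image]
      constructor
      · rintro ⟨⟨b, rfl⟩, hb⟩
        exact ⟨b, Finset.mem_Iio.2 (hf.lt_iff_lt.1 (Fin.lt_def.2 hb)), rfl⟩
      · rintro ⟨b, hb, rfl⟩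
        exact ⟨⟨b, rfl⟩, Fin.lt_def.1 (hf (Finset.mem_Iio.1 hb))⟩
    rw [this, Finset.card_image_of_injective _ (fun b c h => hf.injective (Fin.ext h)), Fin.card_Iio]
  have hout : ∀ i, i ∉ T → shw (dword π) T i = 0 := fun i hi => if_neg hi
  have hpin : ∀ a, pword n σ (f a) = ((f (π a) : ℕ) : ℤ) + 1 := fun a => by rw [pword_fin, h1]
  have hpout : ∀ i, i < n → i ∉ T → pword n σ i = (i : ℤ) + 1 := fun i hi hiT => by
    rw [pword_lt _ hi, h2 ⟨i, hi⟩ hiT]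
  have hlt : ∀ a b, (f a : ℕ) < f b ↔ (a : ℕ) < b := fun a b => by
    rw [← Fin.lt_def, hf.lt_iff_lt, Fin.lt_def]
  refine majStat_congr fun i hi => ?_
  by_cases hi1 : i ∈ T <;> by_cases hi2 : i + 1 ∈ T
  · obtain ⟨a, ha⟩ := (hT _).1 hi1
    obtain ⟨b, hb⟩ := (hT _).1 hi2
    have hab : (b : ℕ) = a + 1 := by
      have g1 := (hlt a b).1 (by omega)
      by_contra g2
      have hc : (a : ℕ) + 1 < k := by have := b.2; omega
      have g3 := (hlt a ⟨a + 1, hc⟩).2 (by simp)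
      have g4 := (hlt ⟨a + 1, hc⟩ b).2 (by simp; omega)
      omega
    have hd := dword_desc π hπ a b hab
    have hl := hlt (π b) (π a)
    rw [← hb, ← ha, hin, hin, hpin, hpin, hd, Fin.lt_def]
    omega
  · obtain ⟨a, ha⟩ := (hT _).1 hi1
    rw [hout _ hi2, hpout _ hi hi2, ← ha, hin, hpin, dword_pos, ← hlt]
    have hne : (f (π a) : ℕ) ≠ i + 1 := fun g => hi2 ((hT _).2 ⟨_, g⟩)
    omega
  · obtain ⟨b, hb⟩ := (hT _).1 hi2
    rw [hout _ hi1, hpout _ (by omega) hi1, ← hb, hin, hpin, dword_neg π hπ, ← hlt]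
    have hne : (f (π b) : ℕ) ≠ i := fun g => hi1 ((hT _).2 ⟨_, g⟩)
    omega
  · rw [hout _ hi1, hout _ hi2, hpout _ hi hi2, hpout _ (by omega) hi1]
    simp

/-- the set of non-fixed points -/
def nfix {n : ℕ} (σ : Equiv.Perm (Fin n)) : Finset ℕ :=
  (Finset.univ.filter (fun i => σ i ≠ i)).map Fin.valEmbedding

lemma mem_nfix {n : ℕ} (σ : Equiv.Perm (Fin n)) (i : Fin n) : (i : ℕ) ∈ nfix σ ↔ σ i ≠ i := by
  simp [nfix, Fin.val_inj]

lemma nfix_subset {n : ℕ} (σ : Equiv.Perm (Fin n)) : nfix σ ⊆ Finset.range n := by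
  intro i hi
  obtain ⟨j, -, rfl⟩ := Finset.mem_map.1 hi
  simp

lemma nfix_eq {n : ℕ} (σ : Equiv.Perm (Fin n)) {T : Finset ℕ} (hT : T ⊆ Finset.range n) :
    nfix σ = T ↔ ∀ i : Fin n, (i : ℕ) ∈ T ↔ σ i ≠ i := by
  constructor
  · rintro rfl i; exact mem_nfix σ i
  · intro h
    ext i
    constructor
    · intro hi
      have hn := Finset.mem_range.1 (nfix_subset σ hi)
      exact (h ⟨i, hn⟩).2 ((mem_nfix σ ⟨i, hn⟩).1 hi)
    · intro hi
      have hn := Finset.mem_range.1 (hT hi)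
      exact (mem_nfix σ ⟨i, hn⟩).2 ((h ⟨i, hn⟩).1 hi)

lemma fiber_sum {K : Type*} [CommRing K] (q : K) {n k : ℕ} (T : Finset ℕ)
    (hT : T ∈ Finset.powersetCard k (Finset.range n)) :
    ∑ σ ∈ Finset.univ.filter (fun σ : Equiv.Perm (Fin n) => nfix σ = T),
        q ^ majStat n (pword n σ)
      = ∑ π ∈ Finset.univ.filter (fun π : Equiv.Perm (Fin k) => ∀ i, π i ≠ i),
        q ^ majStat n (shw (dword π) T) := by
  obtain ⟨hTn, hc⟩ := Finset.mem_powersetCard.1 hT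
  have hlt : ∀ a, T.orderEmbOfFin hc a < n := fun a =>
    Finset.mem_range.1 (hTn (Finset.orderEmbOfFin_mem T hc a))
  let f : Fin k → Fin n := fun a => ⟨T.orderEmbOfFin hc a, hlt a⟩
  have hf : StrictMono f := fun a b hab => Fin.lt_def.2 ((T.orderEmbOfFin hc).strictMono hab)
  have hTf : ∀ i : ℕ, i ∈ T ↔ ∃ a, (f a : ℕ) = i := by
    intro i
    have := Finset.range_orderEmbOfFin T hc
    rw [← Finset.mem_coe, ← this]
    rfl
  let e : Fin k ≃ {x : Fin n // (x : ℕ) ∈ T} := Equiv.ofBijective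
    (fun a => ⟨f a, (hTf _).2 ⟨a, rfl⟩⟩) (by
      constructor
      · intro a b h
        exact hf.injective (congrArg Subtype.val h)
      · rintro ⟨x, hx⟩
        obtain ⟨a, ha⟩ := (hTf _).1 hx
        exact ⟨a, Subtype.ext (Fin.ext ha)⟩)
  have he : ∀ a, (e a : Fin n) = f a := fun a => rfl
  have hx1 : ∀ (π : Equiv.Perm (Fin k)) a, π.extendDomain e (f a) = f (π a) := fun π a => by
    rw [← he, Equiv.Perm.extendDomain_apply_image, he]
  have hx2 : ∀ (π : Equiv.Perm (Fin k)) (i : Fin n), (i : ℕ) ∉ T → π.extendDomain e i = i :=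
    fun π i hi => Equiv.Perm.extendDomain_apply_not_subtype _ _ hi
  symm
  refine Finset.sum_bij (fun π _ => π.extendDomain e) ?_ ?_ ?_ ?_
  · intro π hπ
    have hπ := (Finset.mem_filter.1 hπ).2
    rw [Finset.mem_filter, nfix_eq _ hTn]
    refine ⟨Finset.mem_univ _, fun i => ⟨fun hi => ?_, fun hi => ?_⟩⟩
    · obtain ⟨a, ha⟩ := (hTf _).1 hi
      have ha : f a = i := Fin.ext ha
      rw [← ha, hx1]
      exact fun g => hπ a (hf.injective g)
    · by_contra g
      exact hi (hx2 π i g)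
  · intro π _ π' _ h
    ext a
    have h' := congrArg (fun s : Equiv.Perm (Fin n) => s (f a)) h
    simp only [hx1] at h'
    rw [hf.injective h']
  · intro σ hσ
    have hσ := (nfix_eq σ hTn).1 (Finset.mem_filter.1 hσ).2
    have hp : ∀ x : Fin n, ((σ x : Fin n) : ℕ) ∈ T ↔ (x : ℕ) ∈ T := by
      intro x
      rw [hσ, hσ]
      exact not_congr σ.injective.eq_iff
    let π : Equiv.Perm (Fin k) := (e.trans (σ.subtypePerm hp)).trans e.symm
    have hπ : ∀ a, f (π a) = σ (f a) := by
      intro a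
      rw [← he]
      simp [π, he]
    refine ⟨π, ?_, ?_⟩
    · rw [Finset.mem_filter]
      refine ⟨Finset.mem_univ _, fun a g => ?_⟩
      have := hπ a
      rw [g] at this
      exact (hσ (f a)).1 ((hTf _).2 ⟨a, rfl⟩) this.symm
    · ext i
      by_cases hi : (i : ℕ) ∈ T
      · obtain ⟨a, ha⟩ := (hTf _).1 hi
        have ha : f a = i := Fin.ext ha
        rw [← ha, hx1, hπ]
      · rw [hx2 _ _ hi]
        have := (not_congr (hσ i)).1 hi
        rw [not_not.1 this]
  · intro π hπ
    have hπ := (Finset.mem_filter.1 hπ).2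
    rw [maj_decomp T f hf hTf _ π hπ (hx1 π) (hx2 π)]

lemma sum_maj_eq {K : Type*} [CommRing K] (q : K) (n : ℕ) :
    ∑ σ : Equiv.Perm (Fin n), q ^ majStat n (pword n σ)
      = ∑ k ∈ Finset.range (n + 1), qb q n k * Dmaj q k := by
  rw [← Finset.sum_fiberwise_of_maps_to (s := Finset.univ) (t := (Finset.range n).powerset)
    (g := nfix) (fun σ _ => Finset.mem_powerset.2 (nfix_subset σ)), Finset.sum_powerset,
    Finset.card_range]
  refine Finset.sum_congr rfl fun k _ => ?_
  rw [Finset.sum_congr rfl (fun T hT => fiber_sum q T hT), Finset.sum_comm, Dmaj, Finset.mul_sum]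
  refine Finset.sum_congr rfl fun π hπ => ?_
  have hπ := (Finset.mem_filter.1 hπ).2
  rw [shuffle_sum q (dword π) k (fun i hi => dword_ne π i hi), maj_dword π hπ]

theorem stmt8 (K : Type*) [CommRing K] (q : K) (n : ℕ) :
    (∑ σ ∈ Finset.univ.filter (fun σ : Equiv.Perm (Fin n) => IsDesar n (pword n σ)),
        q ^ invStat n (pword n σ))
      = Dmaj q n := by
  have hK : (∑ σ ∈ Finset.univ.filter (fun σ : Equiv.Perm (Fin n) => IsDesar n (pword n σ)),
        q ^ invStat n (pword n σ)) = Kinv q n := by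
    rw [Kinv, Finset.sum_filter]
    refine Finset.sum_congr rfl fun σ _ => ?_
    split_ifs <;> simp
  rw [hK]
  have hK0 : Kinv q 0 = 1 := by simp [Kinv, IsDesar, invStat]
  refine eq_of_transform q (Kinv q) (Dmaj q) (fun m => ?_) n
  rw [← sum_maj_eq]
  induction m with
  | zero => simp [hK0, qb, majStat]
  | succ m ih =>
    rw [transform_of_rec q (Kinv q) hK0 (Kinv_succ q) m, ih, sum_maj_succ]
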